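/- Let X be a Banach two-sided ℍ-module, let D(A) be a right ℍ-submodule of X, and let A : D(A) → X be a closed right linear operator such that ρ_S(A) ∩ ℝ ≠ ∅. If q0 ∈ ρ_S(A), then u(q0, σ_S(A)) ≥ ‖Q_{q0}(A)‖^{−1/2}, where u(q0,T) := inf_{p∈T} u(p,q0) for nonempty T ⊆ ℍ and u(q0,∅) := +∞. -/

import Mathlib

open MulOpposite Filter Topology Classical

noncomputable section

notation "ℍ" => Quaternion ℝ

/-- A *Banach two-sided `ℍ`-module*: a two-sided `ℍ`-module (left `ℍ`-action, right
`ℍ`-action encoded as a left `ℍᵐᵒᵖ`-action) whose complete norm satisfies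
`‖qx‖ = ‖xq‖ = |q|‖x‖`, and where real scalars act the same on both sides. -/
class QuatBimodule (Y : Type*) [NormedAddCommGroup Y]
    [Module ℍ Y] [Module ℍᵐᵒᵖ Y] : Prop where
  smul_op_comm : ∀ (p q : ℍ) (y : Y), p • (op q • y) = op q • (p • y)
  norm_smul_left : ∀ (q : ℍ) (y : Y), ‖q • y‖ = ‖q‖ * ‖y‖
  norm_smul_right : ∀ (q : ℍ) (y : Y), ‖op q • y‖ = ‖q‖ * ‖y‖
  real_smul_comm : ∀ (r : ℝ) (y : Y), ((r : ℝ) : ℍ) • y = op ((r : ℝ) : ℍ) • y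

variable {X : Type*} [NormedAddCommGroup X] [Module ℍ X] [Module ℍᵐᵒᵖ X]

/-- Membership in `Lin^r(X)`: additive, right `ℍ`-linear, with finite operator
norm (i.e. `‖B x‖` is bounded on the closed unit ball). -/
def MemLinR (B : X → X) : Prop :=
  (∀ x y : X, B (x + y) = B x + B y) ∧
  (∀ (q : ℍ) (x : X), B (op q • x) = op q • B x) ∧
  BddAbove ((fun x : X => ‖B x‖) '' {x : X | ‖x‖ ≤ 1})

/-- The operator norm `‖B‖ = sup {‖B x‖ : ‖x‖ ≤ 1}`. -/
def opNorm (B : X → X) : ℝ :=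
  sSup ((fun x : X => ‖B x‖) '' {x : X | ‖x‖ ≤ 1})

/-- A right linear operator `A : D(A) → X`, where `D(A)` is a right `ℍ`-submodule
of `X`.  It is encoded as a function `X → X` together with its domain; only the
values on the domain are relevant. -/
structure RightLinearOp (X : Type*) [NormedAddCommGroup X]
    [Module ℍ X] [Module ℍᵐᵒᵖ X] where
  dom : Set X
  toFun : X → X
  zero_mem : (0 : X) ∈ dom
  add_mem : ∀ ⦃x⦄, x ∈ dom → ∀ ⦃y⦄, y ∈ dom → x + y ∈ dom
  neg_mem : ∀ ⦃x⦄, x ∈ dom → -x ∈ dom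
  smulR_mem : ∀ (q : ℍ) ⦃x⦄, x ∈ dom → op q • x ∈ dom
  map_add' : ∀ ⦃x⦄, x ∈ dom → ∀ ⦃y⦄, y ∈ dom → toFun (x + y) = toFun x + toFun y
  map_smulR' : ∀ (q : ℍ) ⦃x⦄, x ∈ dom → toFun (op q • x) = op q • toFun x

namespace RightLinearOp

variable (T : RightLinearOp X)

/-- `A` is closed: its graph is closed in `X × X`. -/
def IsClosedOp : Prop := IsClosed {p : X × X | p.1 ∈ T.dom ∧ T.toFun p.1 = p.2}

/-- The domain `D(A²)` of `A²`. -/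
def dom2 : Set X := {x | x ∈ T.dom ∧ T.toFun x ∈ T.dom}

/-- The operator `Δ_q(A) = A² − 2 Re(q) A + |q|² Id`, with domain `D(A²)`. -/
def delta (q : ℍ) (x : X) : X :=
  T.toFun (T.toFun x) - ((2 * q.re : ℝ) : ℍ) • T.toFun x + ((‖q‖ ^ 2 : ℝ) : ℍ) • x

/-- `B` is the inverse of `Δ_q(A) : D(A²) → X`, and `B ∈ Lin^r(X)`. -/
def IsQInv (q : ℍ) (B : X → X) : Prop :=
  MemLinR B ∧ (∀ x : X, B x ∈ T.dom2) ∧ (∀ x : X, T.delta q (B x) = x) ∧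
    ∀ x ∈ T.dom2, B (T.delta q x) = x

/-- The S-resolvent set `ρ_S(A)`. -/
def rhoS : Set ℍ := {q | ∃ B : X → X, T.IsQInv q B}

/-- `Q_q(A) = Δ_q(A)⁻¹ ∈ Lin^r(X)`, for `q ∈ ρ_S(A)` (junk value otherwise). -/
def qres (q : ℍ) : X → X :=
  if h : q ∈ T.rhoS then h.choose else fun _ => 0

/-- The (left) S-resolvent operator `S_q⁻¹(A) = Q_q(A) q̄ − A Q_q(A)`, where the
right scalar multiple of an operator is `(B q̄)(x) = B(q̄ x)`. -/
def sres (q : ℍ) : X → X :=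
  fun x => T.qres q (star q • x) - T.toFun (T.qres q x)

/-- The coefficients `B_n`: `B_{2k} = Q_{q0}(A)^k`, `B_{2k+1} = Q_{q0}(A)^k S_{q0}⁻¹(A)`. -/
def Bop (q0 : ℍ) (n : ℕ) : X → X :=
  if n % 2 = 0 then (T.qres q0)^[n / 2] else (T.qres q0)^[n / 2] ∘ T.sres q0

end RightLinearOp

/-- The quaternionic polynomial `Δ_q(p) = p² − 2 Re(q) p + |q|²`. -/
def deltaPoly (q p : ℍ) : ℍ :=
  p ^ 2 - ((2 * q.re : ℝ) : ℍ) * p + ((‖q‖ ^ 2 : ℝ) : ℍ)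

/-- The "powers" `p_{q0,n}`: `p_{q0,2k}(q) = Δ_{q0}(q)^k`,
`p_{q0,2k+1}(q) = (q − q0) Δ_{q0}(q)^k`. -/
def spow (q0 : ℍ) (n : ℕ) (q : ℍ) : ℍ :=
  if n % 2 = 0 then deltaPoly q0 q ^ (n / 2) else (q - q0) * deltaPoly q0 q ^ (n / 2)

/-- The Cassini pseudo-metric `u(p,q) = √|Δ_q(p)|`. -/
def cassini (p q : ℍ) : ℝ := Real.sqrt ‖deltaPoly q p‖

/-- The Cassini ball `U(q0,R)`. -/
def cassiniBall (q0 : ℍ) (R : ℝ) : Set ℍ := {p : ℍ | cassini p q0 < R}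

/-- The Cassini topology on `ℍ`: the topology induced by the Cassini pseudo-metric,
i.e. the topology generated by the Cassini balls. -/
def cassiniTopology : TopologicalSpace ℍ :=
  TopologicalSpace.generateFrom {U : Set ℍ | ∃ q0 R, 0 < R ∧ U = cassiniBall q0 R}

/-- The spherical derivative of a function `g : ℍ → ℍ`. -/
def sderivQ (g : ℍ → ℍ) (q : ℍ) : ℍ :=
  if q.im = 0 then deriv (fun t : ℝ => g ((t : ℝ) : ℍ)) q.re
  else (g q - g (star q)) * (q - star q)⁻¹

end

namespace QuatBimodule

variable {X : Type*} [NormedAddCommGroup X] [Module ℍ X] [Module ℍᵐᵒᵖ X] [QuatBimodule X]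

/-- The real normed space underlying a two-sided quaternionic normed module. -/
@[reducible]
noncomputable def realNormedSpace : NormedSpace ℝ X where
  smul r x := op (r : ℍ) • x
  one_smul x := by
    change op ((1 : ℝ) : ℍ) • x = x
    simp
  mul_smul r s x := by
    change op ((r * s : ℝ) : ℍ) • x = op (r : ℍ) • op (s : ℍ) • x
    rw [smul_smul, ← op_mul, ← Quaternion.coe_mul, mul_comm]
  smul_zero r := smul_zero (op (r : ℍ))
  smul_add r := smul_add (op (r : ℍ))
  add_smul r s x := by
    change op ((r + s : ℝ) : ℍ) • x = op (r : ℍ) • x + op (s : ℍ) • x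
    rw [← add_smul, ← op_add, Quaternion.coe_add]
  zero_smul x := by
    change op ((0 : ℝ) : ℍ) • x = 0
    simp
  norm_smul_le r x := by
    change ‖op (r : ℍ) • x‖ ≤ _
    rw [norm_smul_right, Quaternion.norm_coe]

attribute [local instance] realNormedSpace

theorem op_coe_smul (r : ℝ) (x : X) : op (r : ℍ) • x = r • x := rfl

theorem coe_smul_eq (r : ℝ) (x : X) : (r : ℍ) • x = r • x := real_smul_comm r x

/-- Right multiplication by a quaternion, as a continuous real linear map. -/
noncomputable def rightMul (q : ℍ) : X →L[ℝ] X :=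
  LinearMap.mkContinuous
    { toFun := fun x => op q • x
      map_add' := smul_add _
      map_smul' := fun r x => by
        rw [← op_coe_smul, ← op_coe_smul, smul_smul, smul_smul, ← op_mul, ← op_mul,
          Quaternion.coe_commutes]
        rfl }
    ‖q‖ fun x => (norm_smul_right q x).le

theorem rightMul_add_rightMul_star (q : ℍ) (x : X) :
    op q • x + op (star q) • x = (2 * q.re) • x := by
  rw [← add_smul, ← op_add, Quaternion.self_add_star, ← op_coe_smul]
  push_cast
  rfl

theorem rightMul_rightMul_star (q : ℍ) (x : X) :
    op q • op (star q) • x = (‖q‖ ^ 2) • x := by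
  rw [smul_smul, ← op_mul, Quaternion.star_mul_self, ← op_coe_smul, Quaternion.normSq_eq_norm_mul_self, sq]

theorem norm_le_opNorm {B : X → X} (hB : MemLinR B) (x : X) : ‖B x‖ ≤ opNorm B * ‖x‖ := by
  rcases eq_or_ne x 0 with rfl | hx
  · have h := hB.2.1 0 0
    simp only [op_zero, zero_smul] at h
    simp [h]
  · have hx' : ‖x‖ ≠ 0 := norm_ne_zero_iff.mpr hx
    have h : ‖B (op ((‖x‖⁻¹ : ℝ) : ℍ) • x)‖ ≤ opNorm B := by
      refine le_csSup hB.2.2 ⟨_, ?_, rfl⟩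
      simp only [Set.mem_ofPred_eq]
      rw [norm_smul_right, Quaternion.norm_coe, norm_inv, norm_norm, inv_mul_cancel₀ hx']
    rw [hB.2.1, norm_smul_right, Quaternion.norm_coe, norm_inv, norm_norm,
      inv_mul_le_iff₀ (by positivity)] at h
    linarith

/-- A member of `Lin^r(X)`, as a continuous real linear map. -/
noncomputable def toCLM {B : X → X} (hB : MemLinR B) : X →L[ℝ] X :=
  LinearMap.mkContinuous
    { toFun := B
      map_add' := hB.1
      map_smul' := fun r x => hB.2.1 r x }
    (opNorm B) (norm_le_opNorm hB)

@[simp]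
theorem toCLM_apply {B : X → X} (hB : MemLinR B) (x : X) : toCLM hB x = B x := rfl

theorem isUnit_one_sub_rightMul_mul [CompleteSpace X] {B : X → X} (hB : MemLinR B) {q : ℍ}
    (hq : ‖q‖ * opNorm B < 1) : IsUnit (1 - rightMul q * toCLM hB) := by
  apply isUnit_one_sub_of_norm_lt_one
  refine lt_of_le_of_lt (ContinuousLinearMap.opNorm_le_bound' _ ?_ fun x _ => ?_) hq
  · refine mul_nonneg (norm_nonneg _) (Real.sSup_nonneg ?_)
    rintro _ ⟨x, -, rfl⟩
    exact norm_nonneg _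
  · rw [mul_assoc]
    change ‖op q • B x‖ ≤ _
    rw [norm_smul_right]
    exact mul_le_mul_of_nonneg_left (norm_le_opNorm hB x) (norm_nonneg _)

theorem isUnit_one_sub_add_sq [CompleteSpace X] {B : X → X} (hB : MemLinR B) {q : ℍ}
    (hq : ‖q‖ * opNorm B < 1) :
    IsUnit (1 - (2 * q.re) • toCLM hB + (‖q‖ ^ 2) • (toCLM hB * toCLM hB)) := by
  have h : 1 - (2 * q.re) • toCLM hB + (‖q‖ ^ 2) • (toCLM hB * toCLM hB) =
      (1 - rightMul q * toCLM hB) * (1 - rightMul (star q) * toCLM hB) := by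
    ext x
    change x - (2 * q.re) • B x + (‖q‖ ^ 2) • B (B x) =
      (x - op (star q) • B x) - op q • B (x - op (star q) • B x)
    have hsub : B (x - op (star q) • B x) = B x - op (star q) • B (B x) := by
      rw [← hB.2.1 _ (B x)]
      exact map_sub (toCLM hB) x (op (star q) • B x)
    rw [hsub, smul_sub, ← rightMul_add_rightMul_star, ← rightMul_rightMul_star]
    abel
  rw [h]
  exact (isUnit_one_sub_rightMul_mul hB hq).mul
    (isUnit_one_sub_rightMul_mul hB (by rwa [norm_star]))

end QuatBimodule

namespace RightLinearOp

open QuatBimodule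

attribute [local instance] QuatBimodule.realNormedSpace

variable {X : Type*} [NormedAddCommGroup X] [Module ℍ X] [Module ℍᵐᵒᵖ X] {T : RightLinearOp X}

theorem dom2_smulR {x : X} (hx : x ∈ T.dom2) (q : ℍ) : op q • x ∈ T.dom2 :=
  ⟨T.smulR_mem q hx.1, by rw [T.map_smulR' q hx.1]; exact T.smulR_mem q hx.2⟩

theorem isQInv_qres {q : ℍ} (hq : q ∈ T.rhoS) : T.IsQInv q (T.qres q) := by
  rw [qres, dif_pos hq]
  exact hq.choose_spec

variable [QuatBimodule X] (T)

/-- The domain as a real subspace. -/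
noncomputable def domain : Submodule ℝ X where
  carrier := T.dom
  zero_mem' := T.zero_mem
  add_mem' := fun hx hy => T.add_mem hx hy
  smul_mem' := fun r _ hx => T.smulR_mem r hx

/-- The operator as a real linear map on its domain. -/
noncomputable def toLinearMap : T.domain →ₗ[ℝ] X where
  toFun x := T.toFun x
  map_add' x y := T.map_add' x.2 y.2
  map_smul' r x := T.map_smulR' r x.2

theorem map_smul {x : X} (r : ℝ) (hx : x ∈ T.domain) : T.toFun (r • x) = r • T.toFun x :=
  T.map_smulR' r hx

theorem map_add {x y : X} (hx : x ∈ T.domain) (hy : y ∈ T.domain) :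
    T.toFun (x + y) = T.toFun x + T.toFun y :=
  T.map_add' hx hy

theorem map_sub {x y : X} (hx : x ∈ T.domain) (hy : y ∈ T.domain) :
    T.toFun (x - y) = T.toFun x - T.toFun y :=
  _root_.map_sub T.toLinearMap ⟨x, hx⟩ ⟨y, hy⟩

/-- `A² x - b A x + c x` for real `b` and `c`. -/
noncomputable def quad (b c : ℝ) (x : X) : X := T.toFun (T.toFun x) - b • T.toFun x + c • x

theorem delta_eq_quad (q : ℍ) (x : X) : T.delta q x = T.quad (2 * q.re) (‖q‖ ^ 2) x := by
  rw [delta, quad, coe_smul_eq, coe_smul_eq]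

/-- The domain of `A⁴`, phrased through `D(A²)`. -/
def dom4 : Set X := {x | x ∈ T.dom2 ∧ T.toFun (T.toFun x) ∈ T.dom2}

variable {T}

theorem apply_quad {x : X} (hx : x ∈ T.dom2) (hxx : T.toFun (T.toFun x) ∈ T.domain) (b c : ℝ) :
    T.toFun (T.quad b c x) =
      T.toFun (T.toFun (T.toFun x)) - b • T.toFun (T.toFun x) + c • T.toFun x := by
  have h0 : x ∈ T.domain := hx.1
  have h1 : T.toFun x ∈ T.domain := hx.2
  rw [quad, T.map_add (T.domain.sub_mem hxx (T.domain.smul_mem b h1)) (T.domain.smul_mem c h0),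
    T.map_sub hxx (T.domain.smul_mem b h1), T.map_smul b h1, T.map_smul c h0]

theorem quad_mem_dom2 {x : X} (hx : x ∈ T.dom4) (b c : ℝ) : T.quad b c x ∈ T.dom2 := by
  obtain ⟨⟨h0, h1⟩, h2, h3⟩ := hx
  refine ⟨T.domain.add_mem (T.domain.sub_mem h2 (T.domain.smul_mem b h1))
    (T.domain.smul_mem c h0), ?_⟩
  rw [apply_quad ⟨h0, h1⟩ h2]
  exact T.domain.add_mem (T.domain.sub_mem h3 (T.domain.smul_mem b h2))
    (T.domain.smul_mem c h1)

theorem mem_dom4_of_quad_mem {x : X} (hx : x ∈ T.dom2) {b c : ℝ} (h : T.quad b c x ∈ T.dom2) :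
    x ∈ T.dom4 := by
  have h0 : x ∈ T.domain := hx.1
  have h1 : T.toFun x ∈ T.domain := hx.2
  have h2 : T.toFun (T.toFun x) ∈ T.domain := by
    have e : T.toFun (T.toFun x) = T.quad b c x + b • T.toFun x - c • x := by
      rw [quad]; abel
    rw [e]
    exact T.domain.sub_mem (T.domain.add_mem h.1 (T.domain.smul_mem b h1))
      (T.domain.smul_mem c h0)
  refine ⟨hx, h2, ?_⟩
  have e : T.toFun (T.toFun (T.toFun x)) =
      T.toFun (T.quad b c x) + b • T.toFun (T.toFun x) - c • T.toFun x := by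
    rw [apply_quad hx h2]; abel
  rw [e]
  exact T.domain.sub_mem (T.domain.add_mem h.2 (T.domain.smul_mem b h2))
    (T.domain.smul_mem c h1)

theorem quad_quad {x : X} (hx : x ∈ T.dom4) (b c b' c' : ℝ) :
    T.quad b c (T.quad b' c' x) =
      T.toFun (T.toFun (T.toFun (T.toFun x))) - (b + b') • T.toFun (T.toFun (T.toFun x)) +
        (c + c' + b * b') • T.toFun (T.toFun x) - (b * c' + b' * c) • T.toFun x +
        (c * c') • x := by
  obtain ⟨⟨h0, h1⟩, h2, h3⟩ := hx
  rw [quad, apply_quad ⟨h0, h1⟩ h2]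
  have e := apply_quad (T := T) ⟨h1, h2⟩ h3 b' c'
  rw [quad] at e
  rw [e, quad]
  module

theorem delta_sub {x y : X} (hx : x ∈ T.dom2) (hy : y ∈ T.dom2) (q : ℍ) :
    T.delta q (x - y) = T.delta q x - T.delta q y := by
  rw [delta_eq_quad, delta_eq_quad, delta_eq_quad, quad, T.map_sub hx.1 hy.1,
    T.map_sub hx.2 hy.2, quad, quad]
  module

theorem dom2_sub {x y : X} (hx : x ∈ T.dom2) (hy : y ∈ T.dom2) : x - y ∈ T.dom2 :=
  ⟨T.domain.sub_mem hx.1 hy.1, by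
    rw [T.map_sub hx.1 hy.1]; exact T.domain.sub_mem hx.2 hy.2⟩

theorem delta_smulR {x : X} (hx : x ∈ T.dom2) (q r : ℍ) :
    T.delta q (op r • x) = op r • T.delta q x := by
  rw [delta, delta, T.map_smulR' r hx.1, T.map_smulR' r hx.2, smul_op_comm, smul_op_comm,
    smul_add, smul_sub]

/-- A bounded real linear right inverse of an injective `Δ_q(A)` is its inverse in `Lin^r(X)`. -/
theorem isQInv_of_rightInverse {q : ℍ} (hinj : ∀ x ∈ T.dom2, T.delta q x = 0 → x = 0)
    (B : X →L[ℝ] X) (hmem : ∀ x, B x ∈ T.dom2) (hB : ∀ x, T.delta q (B x) = x) :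
    T.IsQInv q B := by
  have hcancel : ∀ x ∈ T.dom2, ∀ y ∈ T.dom2, T.delta q x = T.delta q y → x = y := by
    intro x hx y hy h
    refine sub_eq_zero.mp (hinj _ (dom2_sub hx hy) ?_)
    rw [delta_sub hx hy, h, sub_self]
  refine ⟨⟨_root_.map_add B, fun r x => ?_, ⟨‖B‖, ?_⟩⟩, hmem, hB,
    fun x hx => hcancel _ (hmem _) _ hx (hB _)⟩
  · apply hcancel _ (hmem _) _ (dom2_smulR (hmem x) r)
    rw [delta_smulR (hmem x), hB, hB]
  · rintro _ ⟨x, hx, rfl⟩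
    exact B.unit_le_opNorm x hx

theorem delta_mem_dom2 {q : ℍ} {x : X} (hx : x ∈ T.dom4) : T.delta q x ∈ T.dom2 := by
  rw [delta_eq_quad]
  exact quad_mem_dom2 hx _ _

/-- The composition `A Q` is bounded when `A` is closed and `Q` is bounded with range in `D(A)`. -/
noncomputable def compCLM [CompleteSpace X] (hT : T.IsClosedOp) (B : X →L[ℝ] X) (hB : ∀ x, B x ∈ T.domain) :
    X →L[ℝ] X :=
  ContinuousLinearMap.ofIsClosedGraph (g := T.toLinearMap ∘ₗ B.toLinearMap.codRestrict T.domain hB)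
    (by
      have h : Continuous fun z : X × X => (B z.1, z.2) := by fun_prop
      convert IsClosed.preimage h hT using 1
      ext z
      constructor
      · intro hz
        exact ⟨hB _, ((LinearMap.mem_graph_iff _ _).mp hz).symm⟩
      · intro hz
        exact (LinearMap.mem_graph_iff _ _).mpr hz.2.symm)

theorem deltaPoly_eq (q p : ℍ) :
    deltaPoly q p =
      ((2 * (p.re - q.re) : ℝ) : ℍ) * p + ((‖q‖ ^ 2 - ‖p‖ ^ 2 : ℝ) : ℍ) := by
  have hp : ‖p‖ ^ 2 = p.re ^ 2 + p.imI ^ 2 + p.imJ ^ 2 + p.imK ^ 2 := by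
    rw [sq, ← Quaternion.normSq_eq_norm_mul_self, Quaternion.normSq_def']
  rw [deltaPoly, sq p]
  generalize ‖q‖ ^ 2 = m
  generalize ‖p‖ ^ 2 = n at hp ⊢
  ext <;> simp <;> (try rw [hp]) <;> ring

theorem deltaPoly_re (q p : ℍ) :
    (deltaPoly q p).re = 2 * (p.re - q.re) * p.re + (‖q‖ ^ 2 - ‖p‖ ^ 2) := by
  rw [deltaPoly_eq, Quaternion.re_add, Quaternion.coe_mul_eq_smul, Quaternion.re_smul,
    Quaternion.re_coe, smul_eq_mul]

theorem norm_deltaPoly_sq (q p : ℍ) :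
    ‖deltaPoly q p‖ ^ 2 = 4 * (p.re - q.re) ^ 2 * ‖p‖ ^ 2 +
      4 * (p.re - q.re) * (‖q‖ ^ 2 - ‖p‖ ^ 2) * p.re + (‖q‖ ^ 2 - ‖p‖ ^ 2) ^ 2 := by
  have hp : ‖p‖ ^ 2 = p.re ^ 2 + p.imI ^ 2 + p.imJ ^ 2 + p.imK ^ 2 := by
    rw [sq, ← Quaternion.normSq_eq_norm_mul_self, Quaternion.normSq_def']
  rw [deltaPoly_eq, sq ‖_ + _‖, ← Quaternion.normSq_eq_norm_mul_self, Quaternion.normSq_def']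
  generalize ‖q‖ ^ 2 = m
  generalize ‖p‖ ^ 2 = n at hp ⊢
  simp
  rw [hp]
  ring

section reflection

variable (q p : ℍ) {x : X}

theorem delta_delta_reflect (hx : x ∈ T.dom4) :
    T.delta p (T.quad (2 * (2 * q.re - p.re)) (4 * q.re ^ 2 - 4 * q.re * p.re + ‖p‖ ^ 2) x) =
      T.delta q (T.delta q x) - (2 * (deltaPoly q p).re) • T.delta q x +
        (‖deltaPoly q p‖ ^ 2) • x := by
  rw [deltaPoly_re, norm_deltaPoly_sq]
  simp only [delta_eq_quad]
  rw [quad_quad hx, quad_quad hx, quad]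
  module

theorem reflect_delta (hx : x ∈ T.dom4) :
    T.quad (2 * (2 * q.re - p.re)) (4 * q.re ^ 2 - 4 * q.re * p.re + ‖p‖ ^ 2) (T.delta p x) =
      T.delta q (T.delta q x) - (2 * (deltaPoly q p).re) • T.delta q x +
        (‖deltaPoly q p‖ ^ 2) • x := by
  rw [← delta_delta_reflect q p hx]
  simp only [delta_eq_quad]
  rw [quad_quad hx, quad_quad hx]
  module

end reflection

theorem delta_injective_of_near {q p : ℍ} {B : X → X} (hB : T.IsQInv q B)
    [CompleteSpace X] (hp : ‖deltaPoly q p‖ * opNorm B < 1) :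
    ∀ x ∈ T.dom2, T.delta p x = 0 → x = 0 := by
  intro x hx h
  have hx4 : x ∈ T.dom4 := by
    refine mem_dom4_of_quad_mem (b := 2 * p.re) (c := ‖p‖ ^ 2) hx ?_
    rw [← delta_eq_quad, h]
    exact by simpa using dom2_sub hx hx
  have key := reflect_delta q p hx4
  have h0 : T.toFun 0 = 0 := by simpa using T.map_smul (x := 0) 0 T.domain.zero_mem
  rw [h, quad, h0, h0] at key
  have hu := isUnit_one_sub_add_sq hB.1 hp
  obtain ⟨P, hP⟩ := hu.exists_left_inv
  have hQ := congrArg (fun y => toCLM hB.1 (toCLM hB.1 y)) key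
  simp only [_root_.map_add, _root_.map_sub, _root_.map_smul, toCLM_apply, smul_zero, sub_zero,
    add_zero, map_zero, hB.2.2.2 x hx, hB.2.2.2 _ (delta_mem_dom2 hx4)] at hQ
  have hPx := congrArg (fun L : X →L[ℝ] X => L x) hP
  change P (x - (2 * (deltaPoly q p).re) • B x + (‖deltaPoly q p‖ ^ 2) • B (B x)) = x at hPx
  rw [← hPx, ← hQ]
  simp

theorem mem_rhoS_of_near [CompleteSpace X] (hT : T.IsClosedOp) {q p : ℍ} {B : X → X}
    (hB : T.IsQInv q B) (hp : ‖deltaPoly q p‖ * opNorm B < 1) : p ∈ T.rhoS := by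
  obtain ⟨P, hP⟩ := (isUnit_one_sub_add_sq hB.1 hp).exists_right_inv
  set Q : X →L[ℝ] X := toCLM hB.1 with hQ
  have hmem : ∀ x, B (B x) ∈ T.dom4 := fun x => by
    refine mem_dom4_of_quad_mem (b := 2 * q.re) (c := ‖q‖ ^ 2) (hB.2.1 _) ?_
    rw [← delta_eq_quad, hB.2.2.1]
    exact hB.2.1 _
  set b := 2 * (2 * q.re - p.re) with hb
  set c := 4 * q.re ^ 2 - 4 * q.re * p.re + ‖p‖ ^ 2 with hc
  let R : X →L[ℝ] X :=
    (1 + (2 * q.re - b) • compCLM hT Q (fun x => (hB.2.1 x).1) + (c - ‖q‖ ^ 2) • Q) * Q * P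
  have hR : ∀ x, R x = T.quad b c (B (B (P x))) := fun x => by
    change B (P x) + (2 * q.re - b) • T.toFun (B (B (P x))) +
      (c - ‖q‖ ^ 2) • B (B (P x)) = _
    have h := hB.2.2.1 (B (P x))
    rw [delta_eq_quad] at h
    nth_rewrite 1 [← h]
    rw [quad, quad]
    module
  refine ⟨R, isQInv_of_rightInverse (delta_injective_of_near hB hp) R (fun x => ?_) fun x => ?_⟩
  · rw [hR]
    exact quad_mem_dom2 (hmem _) _ _
  · rw [hR, hb, hc, delta_delta_reflect q p (hmem _), hB.2.2.1, hB.2.2.1]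
    exact congrArg (fun L : X →L[ℝ] X => L x) hP

end RightLinearOp

/-- Corollary `cor1`: if `q0 ∈ ρ_S(A)`, then
`u(q0, σ_S(A)) ≥ ‖Q_{q0}(A)‖^{-1/2}`, i.e. every point `p` of the S-spectrum
`σ_S(A) = ℍ \ ρ_S(A)` satisfies `u(p,q0) ≥ ‖Q_{q0}(A)‖^{-1/2}` (when `σ_S(A) = ∅`
the infimum is `+∞` and the claim is vacuous). -/
theorem stmt6 {X : Type*} [NormedAddCommGroup X] [CompleteSpace X]
    [Module ℍ X] [Module ℍᵐᵒᵖ X] [QuatBimodule X]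
    (T : RightLinearOp X) (hT : T.IsClosedOp)
    (hreal : ∃ r : ℝ, ((r : ℝ) : ℍ) ∈ T.rhoS)
    (q0 : ℍ) (hq0 : q0 ∈ T.rhoS) :
    ∀ p : ℍ, p ∉ T.rhoS → (Real.sqrt (opNorm (T.qres q0)))⁻¹ ≤ cassini p q0 := by
  intro p hp
  by_contra! hlt
  refine hp (RightLinearOp.mem_rhoS_of_near hT (RightLinearOp.isQInv_qres hq0) ?_)
  rw [cassini] at hlt
  set N := opNorm (T.qres q0)
  have hN : 0 < Real.sqrt N := inv_pos.mp (lt_of_le_of_lt (Real.sqrt_nonneg _) hlt)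
  rw [← one_div, lt_div_iff₀ hN, ← Real.sqrt_mul (norm_nonneg _), Real.sqrt_lt' one_pos,
    one_pow] at hlt
  exact hlt
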